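/- arXiv:1510.06118 — 2 statements merged into one kernel-verified Lean document; each statement's English description precedes it below -/
import Mathlib

section
/- Let k be a field, V a finite-dimensional k-vector space, and let g and h be pseudo-reflections of V such that the subgroup G = ⟨g, h⟩ of GL(V) they generate is finite of order invertible in k (coprime to the characteristic of k). Suppose the fixed hyperplanes of the pseudo-reflections in G are in normal crossing position, in the sense that for all pseudo-reflections σ, τ, ρ ∈ G, if V_σ ∩ V_τ ⊆ V_ρ then V_ρ = V_σ or V_ρ = V_τ. Then the group G is abelian. -/
/-- The fixed subspace `V_g = {v : V | g v = v}` of a linear automorphism `g`. -/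
def fixedSpace {k V : Type*} [Field k] [AddCommGroup V] [Module k V]
    (g : V ≃ₗ[k] V) : Submodule k V :=
  LinearMap.ker ((g : V →ₗ[k] V) - LinearMap.id)

/-- `g` is a *pseudo-reflection* if the image of `1 - g` is one-dimensional. -/
def IsPseudoReflection {k V : Type*} [Field k] [AddCommGroup V] [Module k V]
    (g : V ≃ₗ[k] V) : Prop :=
  Module.finrank k (LinearMap.range (LinearMap.id - (g : V →ₗ[k] V))) = 1

section PseudoReflection

variable {k V : Type*} [Field k] [AddCommGroup V] [Module k V]

theorem mem_fixedSpace_iff {g : V ≃ₗ[k] V} {v : V} : v ∈ fixedSpace g ↔ g v = v := by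
  simp [fixedSpace, sub_eq_zero]

/-- A pseudo-reflection has the form `v ↦ v - f v • b` with `b ≠ 0`. -/
theorem IsPseudoReflection.exists_apply_eq_sub {g : V ≃ₗ[k] V} (hg : IsPseudoReflection g) :
    ∃ (f : V →ₗ[k] k) (b : V), b ≠ 0 ∧ ∀ v, g v = v - f v • b := by
  have : Module.Finite k (LinearMap.range (LinearMap.id - (g : V →ₗ[k] V))) :=
    Module.finite_of_finrank_eq_succ hg
  let e : LinearMap.range (LinearMap.id - (g : V →ₗ[k] V)) ≃ₗ[k] k :=
    LinearEquiv.ofFinrankEq _ _ (hg.trans (Module.finrank_self k).symm)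
  refine ⟨e.toLinearMap ∘ₗ LinearMap.rangeRestrict _, (e.symm 1 : _), by simp, fun v ↦ ?_⟩
  have h : e (LinearMap.rangeRestrict (LinearMap.id - (g : V →ₗ[k] V)) v) • e.symm 1 =
      LinearMap.rangeRestrict (LinearMap.id - (g : V →ₗ[k] V)) v := by
    rw [← map_smul]; simp
  exact (sub_eq_of_eq_add (sub_eq_iff_eq_add'.1 (congrArg Subtype.val h).symm)).symm

theorem IsPseudoReflection.conj {g : V ≃ₗ[k] V} (hg : IsPseudoReflection g) (h : V ≃ₗ[k] V) :
    IsPseudoReflection (h * g * h⁻¹) := by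
  have key : LinearMap.id - ((h * g * h⁻¹ : V ≃ₗ[k] V) : V →ₗ[k] V) =
      h.toLinearMap ∘ₗ (LinearMap.id - (g : V →ₗ[k] V)) ∘ₗ h.symm.toLinearMap := by
    ext v
    change v - h (g (h.symm v)) = h (h.symm v - g (h.symm v))
    simp
  unfold IsPseudoReflection at *
  rw [key, LinearMap.range_comp, LinearMap.range_comp_of_range_eq_top _ h.symm.range]
  exact (LinearEquiv.finrank_map_eq h _).trans hg

theorem mem_fixedSpace_conj {g h : V ≃ₗ[k] V} {v : V} :
    h v ∈ fixedSpace (h * g * h⁻¹) ↔ v ∈ fixedSpace g := by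
  rw [mem_fixedSpace_iff, mem_fixedSpace_iff]
  change h (g (h.symm (h v))) = h v ↔ _
  simp

theorem inf_le_fixedSpace_conj (g h : V ≃ₗ[k] V) :
    fixedSpace g ⊓ fixedSpace h ≤ fixedSpace (h * g * h⁻¹) := by
  rintro v ⟨hvg, hvh⟩
  rw [← mem_fixedSpace_iff.1 hvh]
  exact mem_fixedSpace_conj.2 hvg

/-- If the fixed space of `h g h⁻¹` is one of those of `g` and `h`, then `h` stabilizes the fixed
space of `g`. -/
theorem apply_mem_fixedSpace_of_conj {g h : V ≃ₗ[k] V}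
    (H : fixedSpace (h * g * h⁻¹) = fixedSpace g ∨ fixedSpace (h * g * h⁻¹) = fixedSpace h)
    {v : V} (hv : v ∈ fixedSpace g) : h v ∈ fixedSpace g := by
  have hc : h v ∈ fixedSpace (h * g * h⁻¹) := mem_fixedSpace_conj.2 hv
  rcases H with H | H
  · rwa [H] at hc
  · rw [H, mem_fixedSpace_iff, h.injective.eq_iff] at hc
    rwa [hc]

/-- If `h` stabilizes, but does not fix pointwise, the fixed space of `g`, then `g` fixes the
direction of the pseudo-reflection `h`. -/
theorem mem_fixedSpace_of_stabilizes {g h : V ≃ₗ[k] V} {f : V →ₗ[k] k} {a : V}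
    (hf : ∀ v, h v = v - f v • a) (hs : ∀ v ∈ fixedSpace g, h v ∈ fixedSpace g)
    (hle : ¬ fixedSpace g ≤ fixedSpace h) : a ∈ fixedSpace g := by
  obtain ⟨v, hvg, hvh⟩ := SetLike.not_le_iff_exists.1 hle
  have hfv : f v ≠ 0 := fun h0 ↦ hvh (mem_fixedSpace_iff.2 (by simp [hf, h0]))
  have hmem := (fixedSpace g).sub_mem hvg (hs v hvg)
  rw [hf, sub_sub_cancel] at hmem
  exact ((fixedSpace g).smul_mem_iff hfv).1 hmem

theorem LinearEquiv.pow_apply_of_apply_sub_eq {c : V ≃ₗ[k] V} {w : V}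
    (h : c (c w - w) = c w - w) (n : ℕ) : (c ^ n) w = w + (n : k) • (c w - w) := by
  induction n with
  | zero => simp
  | succ n ih =>
    rw [pow_succ', LinearEquiv.mul_apply, ih, map_add, map_smul, h]
    push_cast
    module

/-- Two pseudo-reflections with the same fixed hyperplane commute if their commutator satisfies
`c ^ n = 1` with `n` invertible in `k`. -/
theorem IsPseudoReflection.commute_of_fixedSpace_eq {g h : V ≃ₗ[k] V}
    (hg : IsPseudoReflection g) (hh : IsPseudoReflection h) (heq : fixedSpace g = fixedSpace h)
    {n : ℕ} (hn : (n : k) ≠ 0) (hpow : (g * h * (h * g)⁻¹) ^ n = 1) : g * h = h * g := by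
  obtain ⟨f, b, hb, hgf⟩ := hg.exists_apply_eq_sub
  obtain ⟨f', a, ha, hhf⟩ := hh.exists_apply_eq_sub
  have hker (v : V) : f v = 0 ↔ f' v = 0 := by
    have : v ∈ fixedSpace g ↔ v ∈ fixedSpace h := by rw [heq]
    simpa [mem_fixedSpace_iff, hgf, hhf, ha, hb] using this
  have hprop (x y : V) : f x * f' y = f y * f' x := by
    have := (hker (f x • y - f y • x)).1 (by simp [mul_comm])
    simpa [sub_eq_zero] using this
  ext v
  set c := g * h * (h * g)⁻¹ with hc
  have hcw (u : V) : c (h (g u)) = g (h u) := by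
    have : c * (h * g) = g * h := by rw [hc]; group
    exact congrArg (fun x : V ≃ₗ[k] V ↦ x u) this
  have hmem : g (h v) - h (g v) ∈ fixedSpace g := by
    have h0 : f (g (h v) - h (g v)) = 0 := by
      simp only [hgf, hhf, map_sub, map_smul, smul_eq_mul]
      linear_combination f a * hprop b v
    exact mem_fixedSpace_iff.2 (by rw [hgf, h0, zero_smul, sub_zero])
  have hcfix {u : V} (hu : u ∈ fixedSpace g) : c u = u := by
    have hug := mem_fixedSpace_iff.1 hu
    have huh := mem_fixedSpace_iff.1 (heq ▸ hu)
    simpa [hug, huh] using hcw u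
  have := LinearEquiv.pow_apply_of_apply_sub_eq (c := c) (w := h (g v))
    (by rw [hcw]; exact hcfix hmem) n
  rw [hpow, hcw, LinearEquiv.coe_one, id_eq, left_eq_add, smul_eq_zero, sub_eq_zero] at this
  exact this.resolve_left hn

end PseudoReflection

/-- Let `g` and `h` be pseudo-reflections of a finite-dimensional vector
space `V` over `k` generating a finite subgroup `G = ⟨g, h⟩` of `GL(V)` of order invertible
in `k`.  If the fixed hyperplanes of the pseudo-reflections of `G` are in normal crossing
position (whenever `V_σ ∩ V_τ ⊆ V_ρ` for pseudo-reflections `σ, τ, ρ ∈ G`, one has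
`V_ρ = V_σ` or `V_ρ = V_τ`), then `G` is abelian. -/
theorem abelian_of_normal_crossing_pseudoReflections
    {k V : Type*} [Field k] [AddCommGroup V] [Module k V] [FiniteDimensional k V]
    (g h : V ≃ₗ[k] V)
    (hg : IsPseudoReflection g) (hh : IsPseudoReflection h)
    (hfin : Finite (Subgroup.closure {g, h} : Subgroup (V ≃ₗ[k] V)))
    (hord : (Nat.card (Subgroup.closure {g, h} : Subgroup (V ≃ₗ[k] V)) : k) ≠ 0)
    (hnc : ∀ σ τ ρ : V ≃ₗ[k] V,
      σ ∈ Subgroup.closure {g, h} → τ ∈ Subgroup.closure {g, h} →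
      ρ ∈ Subgroup.closure {g, h} →
      IsPseudoReflection σ → IsPseudoReflection τ → IsPseudoReflection ρ →
      fixedSpace σ ⊓ fixedSpace τ ≤ fixedSpace ρ →
      fixedSpace ρ = fixedSpace σ ∨ fixedSpace ρ = fixedSpace τ) :
    ∀ a b : V ≃ₗ[k] V, a ∈ Subgroup.closure {g, h} → b ∈ Subgroup.closure {g, h} →
      a * b = b * a := by
  have hgG : g ∈ Subgroup.closure {g, h} := Subgroup.subset_closure (by simp)
  have hhG : h ∈ Subgroup.closure {g, h} := Subgroup.subset_closure (by simp)
  have hcomm : g * h = h * g := by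
    by_cases heq : fixedSpace g = fixedSpace h
    · refine hg.commute_of_fixedSpace_eq hh heq hord ?_
      have hcG : g * h * (h * g)⁻¹ ∈ Subgroup.closure {g, h} :=
        mul_mem (mul_mem hgG hhG) (inv_mem (mul_mem hhG hgG))
      exact congrArg Subtype.val
        (pow_card_eq_one' (x := (⟨_, hcG⟩ : Subgroup.closure {g, h})))
    · obtain ⟨f, b, -, hgf⟩ := hg.exists_apply_eq_sub
      obtain ⟨f', a, -, hhf⟩ := hh.exists_apply_eq_sub
      have hgh : ¬ fixedSpace g ≤ fixedSpace h := fun hle ↦ heq <| by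
        simpa [eq_comm] using hnc g g h hgG hgG hhG hg hg hh (inf_le_left.trans hle)
      have hhg : ¬ fixedSpace h ≤ fixedSpace g := fun hle ↦ heq <| by
        simpa using hnc h h g hhG hhG hgG hh hh hg (inf_le_left.trans hle)
      have hag : a ∈ fixedSpace g := mem_fixedSpace_of_stabilizes hhf
        (fun v ↦ apply_mem_fixedSpace_of_conj <|
          hnc g h _ hgG hhG (mul_mem (mul_mem hhG hgG) (inv_mem hhG)) hg hh (hg.conj h)
            (inf_le_fixedSpace_conj g h)) hgh
      have hbh : b ∈ fixedSpace h := mem_fixedSpace_of_stabilizes hgf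
        (fun v ↦ apply_mem_fixedSpace_of_conj <|
          hnc h g _ hhG hgG (mul_mem (mul_mem hgG hhG) (inv_mem hgG)) hh hg (hh.conj g)
            (inf_le_fixedSpace_conj h g)) hhg
      rw [mem_fixedSpace_iff] at hag hbh
      ext v
      rw [LinearEquiv.mul_apply, LinearEquiv.mul_apply, hhf v, hgf v, map_sub, map_sub, map_smul,
        map_smul, hag, hbh, hgf v, hhf v]
      abel
  intro a b ha hb
  refine Subgroup.closure_induction₂ (p := fun x y _ _ ↦ Commute x y) ?_ ?_ ?_ ?_ ?_ ?_ ?_ ha hb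
  · rintro x y (rfl | rfl) (rfl | rfl)
    exacts [Commute.refl _, hcomm, hcomm.symm, Commute.refl _]
  · exact fun x _ ↦ Commute.one_left x
  · exact fun x _ ↦ Commute.one_right x
  · exact fun _ _ _ _ _ _ h₁ h₂ ↦ h₁.mul_left h₂
  · exact fun _ _ _ _ _ _ h₁ h₂ ↦ h₁.mul_right h₂
  · exact fun _ _ _ _ h₁ ↦ h₁.inv_left
  · exact fun _ _ _ _ h₁ ↦ h₁.inv_right
end

section
/- Let k be a field, V a finite-dimensional k-vector space, and let g and g′ be pseudo-reflections of V generating a finite subgroup of GL(V) whose order is invertible in k. If g and g′ have the same fixed hyperplane, V_g = V_{g′}, and the same characteristic polynomial, then g = g′. -/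
/-- The fixed subspace of a pseudo-reflection is the kernel of a nonzero linear form. -/
theorem IsPseudoReflection.exists_fixedSpace_eq_ker {k V : Type*} [Field k] [AddCommGroup V]
    [Module k V] {g : V ≃ₗ[k] V} (hg : IsPseudoReflection g) :
    ∃ (f : Module.Dual k V) (x : V), f x = 1 ∧ fixedSpace g = LinearMap.ker f := by
  have hg' : Module.finrank k (LinearMap.range (LinearMap.id - (g : V →ₗ[k] V))) = 1 := hg
  have := Module.finite_of_finrank_eq_succ hg'
  let e : LinearMap.range (LinearMap.id - (g : V →ₗ[k] V)) ≃ₗ[k] k :=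
    LinearEquiv.ofFinrankEq _ _ (by rw [hg', Module.finrank_self])
  obtain ⟨x, hx⟩ := LinearMap.surjective_rangeRestrict
    (LinearMap.id - (g : V →ₗ[k] V)) (e.symm 1)
  refine ⟨e.toLinearMap ∘ₗ LinearMap.rangeRestrict _, x, by simp [hx], ?_⟩
  rw [LinearEquiv.ker_comp, LinearMap.ker_rangeRestrict, fixedSpace,
    ← neg_sub LinearMap.id, LinearMap.ker_neg]

/-- An automorphism fixing the kernel of a linear form is a transvection, in the sense allowing
dilations, along that form. -/
theorem eq_transvection_of_fixedSpace_eq_ker {k V : Type*} [Field k] [AddCommGroup V]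
    [Module k V] {g : V ≃ₗ[k] V} {f : Module.Dual k V} {x : V} (hx : f x = 1)
    (hg : fixedSpace g = LinearMap.ker f) :
    (g : V →ₗ[k] V) = LinearMap.transvection f (g x - x) := by
  ext y
  have hy : y - f y • x ∈ fixedSpace g := by
    simp [hg, hx]
  simp only [fixedSpace, LinearMap.mem_ker, LinearMap.sub_apply, LinearEquiv.coe_coe,
    LinearMap.id_apply, map_sub, map_smul] at hy
  rw [LinearMap.transvection.apply, LinearEquiv.coe_coe, ← sub_eq_zero, ← hy]
  abel

theorem LinearEquiv.transvection_pow_apply {k V : Type*} [CommRing k] [AddCommGroup V]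
    [Module k V] {f : Module.Dual k V} {v : V} (h : f v = 0) (n : ℕ) (x : V) :
    (LinearEquiv.transvection h ^ n) x = x + n • f x • v := by
  induction n with
  | zero => simp
  | succ n ih =>
    rw [pow_succ', LinearEquiv.mul_apply, ih, LinearEquiv.transvection.apply]
    simp [h, add_smul, add_assoc]

/-- Let `g` and `g'` be pseudo-reflections of a finite-dimensional
vector space `V` generating a finite subgroup of `GL(V)` of order invertible in `k`.
If they have the same fixed hyperplane and the same characteristic polynomial,
then `g = g'`. -/
theorem pseudoReflection_eq_of_fixedSpace_eq_of_charpoly_eq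
    {k V : Type*} [Field k] [AddCommGroup V] [Module k V] [FiniteDimensional k V]
    (g g' : V ≃ₗ[k] V) (hg : IsPseudoReflection g) (hg' : IsPseudoReflection g')
    (hfin : Finite (Subgroup.closure {g, g'} : Subgroup (V ≃ₗ[k] V)))
    (hord : (Nat.card (Subgroup.closure {g, g'} : Subgroup (V ≃ₗ[k] V)) : k) ≠ 0)
    (hfix : fixedSpace g = fixedSpace g')
    (hcp : (g : V →ₗ[k] V).charpoly = (g' : V →ₗ[k] V).charpoly) :
    g = g' := by
  obtain ⟨f, x, hx, hf⟩ := hg.exists_fixedSpace_eq_ker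
  have hgt := eq_transvection_of_fixedSpace_eq_ker hx hf
  have hgt' := eq_transvection_of_fixedSpace_eq_ker hx (hfix.symm.trans hf)
  have hdet : LinearMap.det (g : V →ₗ[k] V) = LinearMap.det (g' : V →ₗ[k] V) := by
    rw [LinearMap.det_eq_sign_charpoly_coeff, LinearMap.det_eq_sign_charpoly_coeff, hcp]
  have hv : f (g' x - g x) = 0 := by
    rw [hgt, hgt', LinearMap.transvection.det, LinearMap.transvection.det, add_right_inj,
      map_sub, map_sub, sub_left_inj] at hdet
    rw [map_sub, hdet, sub_self]
  have hgapply (y : V) : g y = y + f y • (g x - x) :=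
    LinearMap.congr_fun hgt y
  have hgapply' (y : V) : g' y = y + f y • (g' x - x) :=
    LinearMap.congr_fun hgt' y
  have hmul : g' = g * LinearEquiv.transvection hv := by
    ext y
    rw [LinearEquiv.mul_apply, LinearEquiv.transvection.apply, map_add, map_smul,
      hgapply (g' x - g x), hv, zero_smul, add_zero, hgapply y, hgapply' y]
    module
  have hmem : LinearEquiv.transvection hv ∈ Subgroup.closure {g, g'} := by
    rw [← inv_mul_eq_iff_eq_mul.mpr hmul]
    exact mul_mem (inv_mem (Subgroup.subset_closure (by simp)))
      (Subgroup.subset_closure (by simp))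
  have hpow : LinearEquiv.transvection hv ^ Nat.card (Subgroup.closure {g, g'}) = 1 :=
    congrArg Subtype.val (pow_card_eq_one' (x := (⟨_, hmem⟩ : Subgroup.closure {g, g'})))
  have hzero := LinearEquiv.transvection_pow_apply hv (Nat.card (Subgroup.closure {g, g'})) x
  rw [hpow, LinearEquiv.coe_one, id, left_eq_add, hx, one_smul, ← Nat.cast_smul_eq_nsmul k,
    smul_eq_zero_iff_right hord, sub_eq_zero] at hzero
  ext y
  rw [hgapply, hgapply', hzero]
end
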